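/- arXiv:2401.08482 — 2 statements merged into one kernel-verified Lean document; each statement's English description precedes it below -/
import Mathlib

section
/- Let γ : ℝ → ℝ be continuous with 0 < γ(z) < 1 for all z ∈ ℝ and lim_{z→−∞} γ(z) = 0, and let μ > 0. If x : ℝ → ℝ is differentiable, satisfies x'(t) = γ(μt) x(t)(1 − x(t)²) − (1 − γ(μt)) x(t) for all t ∈ ℝ, and x(t) → 0 as t → −∞, then x(t) = 0 for all t ∈ ℝ. -/
open Filter

theorem stmt9 (γ : ℝ → ℝ) (hγc : Continuous γ)
    (hrange : ∀ z, 0 < γ z ∧ γ z < 1)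
    (hlim : Tendsto γ atBot (nhds 0)) (μ : ℝ) (hμ : 0 < μ)
    (x : ℝ → ℝ)
    (hx : ∀ t, HasDerivAt x
      (γ (μ * t) * x t * (1 - x t ^ 2) - (1 - γ (μ * t)) * x t) t)
    (hxlim : Tendsto x atBot (nhds 0)) :
    ∀ t, x t = 0 := by
  have hsq : ∀ t, HasDerivAt (fun s => x s ^ 2)
      (2 * (2 * γ (μ * t) - 1) * x t ^ 2 - 2 * γ (μ * t) * (x t ^ 2) ^ 2) t := by
    intro t
    refine ((hx t).fun_pow 2).congr_deriv ?_
    push_cast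
    ring
  -- Far in the past the linear coefficient is negative, so `x ^ 2` is nonincreasing there.
  obtain ⟨T, hT⟩ : ∃ T, ∀ t ≤ T, γ (μ * t) < 1 / 2 :=
    eventually_atBot.1 <| (hlim.comp (tendsto_id.const_mul_atBot hμ)).eventually_lt_const
      (by norm_num : (0 : ℝ) < 1 / 2)
  have hanti : AntitoneOn (fun s => x s ^ 2) (Set.Iic T) := by
    refine antitoneOn_of_deriv_nonpos (convex_Iic T)
      (fun t _ => (hsq t).continuousAt.continuousWithinAt)
      (fun t _ => (hsq t).differentiableAt.differentiableWithinAt) fun t ht => ?_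
    rw [(hsq t).deriv]
    have hneg := hT t (Set.mem_Iic.1 (interior_subset ht))
    have hpos := (hrange (μ * t)).1
    nlinarith [mul_nonneg (by linarith : 0 ≤ 1 - 2 * γ (μ * t)) (sq_nonneg (x t)),
      mul_nonneg hpos.le (sq_nonneg (x t ^ 2))]
  have hpast : ∀ t ≤ T, x t ^ 2 ≤ 0 := by
    intro t ht
    have hlim_sq : Tendsto (fun s => x s ^ 2) atBot (nhds 0) := by
      simpa using hxlim.pow 2
    refine ge_of_tendsto hlim_sq ?_
    filter_upwards [eventually_le_atBot t] with s hs
    exact hanti (hs.trans ht) ht hs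
  -- A Grönwall argument propagates the vanishing forward in time.
  have hexp : ∀ t, HasDerivAt (fun s => x s ^ 2 * Real.exp (-2 * s))
      ((2 * (2 * γ (μ * t) - 1) * x t ^ 2 - 2 * γ (μ * t) * (x t ^ 2) ^ 2) * Real.exp (-2 * t)
        + x t ^ 2 * (Real.exp (-2 * t) * (-2))) t := by
    intro t
    exact (hsq t).mul (by simpa using ((hasDerivAt_id t).const_mul (-2)).exp)
  have hanti_exp : Antitone fun s => x s ^ 2 * Real.exp (-2 * s) := by
    refine antitone_of_deriv_nonpos (fun t => (hexp t).differentiableAt) fun t => ?_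
    rw [(hexp t).deriv]
    have hcoeff : 2 * (2 * γ (μ * t) - 1) * x t ^ 2 - 2 * γ (μ * t) * (x t ^ 2) ^ 2
        - 2 * x t ^ 2 ≤ 0 := by
      nlinarith [mul_nonneg (sub_nonneg.2 (hrange (μ * t)).2.le) (sq_nonneg (x t)),
        mul_nonneg (hrange (μ * t)).1.le (sq_nonneg (x t ^ 2))]
    nlinarith [mul_nonpos_of_nonpos_of_nonneg hcoeff (Real.exp_pos (-2 * t)).le]
  intro t
  have hmin : x (min t T) ^ 2 * Real.exp (-2 * min t T) ≤ 0 :=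
    mul_nonpos_of_nonpos_of_nonneg (hpast _ (min_le_right t T)) (Real.exp_pos _).le
  have ht : x t ^ 2 * Real.exp (-2 * t) ≤ 0 := (hanti_exp (min_le_left t T)).trans hmin
  have hx0 : x t ^ 2 ≤ 0 := nonpos_of_mul_nonpos_left ht (Real.exp_pos _)
  exact pow_eq_zero_iff two_ne_zero |>.1 (le_antisymm hx0 (sq_nonneg _))
end

section
/- Let T > 0, let g : [0, T] → [0, 1] and θ : [0, T] → ℝ be continuous, and let x, y : [0, T] → [−1/2, 1/2] be differentiable functions satisfying x'(t) = −g(t) x(t)(1 − x(t)²) − (1 − g(t)) x(t) + θ(t) and y'(t) = −g(t) y(t)(1 − y(t)²) − (1 − g(t)) y(t) + θ(t) for all t ∈ [0, T]. Then |x(t) − y(t)| ≤ e^{−t/4} |x(0) − y(0)| for all t ∈ [0, T]. -/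
open Set

/-- One-sided Lipschitz estimate with constant `-1/4` for the cubic vector field on
`[-1/2, 1/2]`. -/
lemma cubic_field_one_sided_lipschitz {a b c θ : ℝ} (hc : c ∈ Icc (0:ℝ) 1)
    (ha : a ∈ Icc (-(1/2) : ℝ) (1/2)) (hb : b ∈ Icc (-(1/2) : ℝ) (1/2)) :
    (a - b) * ((-(c * (a * (1 - a ^ 2))) - (1 - c) * a + θ)
      - (-(c * (b * (1 - b ^ 2))) - (1 - c) * b + θ)) ≤ -(1/4) * (a - b) ^ 2 := by
  obtain ⟨hc0, hc1⟩ := hc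
  obtain ⟨ha0, ha1⟩ := ha
  obtain ⟨hb0, hb1⟩ := hb
  have hq : a ^ 2 + a * b + b ^ 2 ≤ 3/4 := by nlinarith
  have hq0 : 0 ≤ a ^ 2 + a * b + b ^ 2 := by nlinarith [sq_nonneg (a + b), sq_nonneg a, sq_nonneg b]
  have hcq : c * (a ^ 2 + a * b + b ^ 2) ≤ 3/4 := by nlinarith
  nlinarith [mul_le_mul_of_nonneg_left hcq (sq_nonneg (a - b))]

/-- If `w w' ≤ -k w²` on `[0, T]`, then `|w|` decays at least like `exp (-k t)`. -/
lemma abs_le_exp_mul_of_mul_deriv_le {T k : ℝ} {w w' : ℝ → ℝ}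
    (hw : ∀ t ∈ Icc (0:ℝ) T, HasDerivAt w (w' t) t)
    (hle : ∀ t ∈ Icc (0:ℝ) T, w t * w' t ≤ -k * w t ^ 2) {t : ℝ} (ht : t ∈ Icc (0:ℝ) T) :
    |w t| ≤ Real.exp (-(k * t)) * |w 0| := by
  have hderiv : ∀ s ∈ Icc (0:ℝ) T, HasDerivAt (fun s => (Real.exp (k * s) * w s) ^ 2)
      (2 * Real.exp (k * s) ^ 2 * (k * w s ^ 2 + w s * w' s)) s := fun s hs => by
    convert! ((((hasDerivAt_id s).const_mul k).exp).mul (hw s hs)).pow 2 using 1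
    simp
    ring
  have hanti : AntitoneOn (fun s => (Real.exp (k * s) * w s) ^ 2) (Icc 0 T) :=
    antitoneOn_of_hasDerivWithinAt_nonpos (convex_Icc 0 T)
      (fun s hs => (hderiv s hs).continuousAt.continuousWithinAt)
      (fun s hs => (hderiv s (interior_subset hs)).hasDerivWithinAt)
      (fun s hs => mul_nonpos_of_nonneg_of_nonpos (by positivity)
        (by linarith [hle s (interior_subset hs)]))
  have hsq := hanti ⟨le_rfl, ht.1.trans ht.2⟩ ht ht.1
  have habs := sq_le_sq.mp hsq
  rw [abs_mul, abs_mul, mul_zero, Real.exp_zero, abs_one, one_mul, Real.abs_exp] at habs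
  rwa [Real.exp_neg, le_inv_mul_iff₀ (Real.exp_pos _)]

theorem stmt13 (T : ℝ) (hT : 0 < T)
    (g θ : ℝ → ℝ)
    (hgc : ContinuousOn g (Icc 0 T)) (hgr : ∀ t ∈ Icc (0:ℝ) T, g t ∈ Icc (0:ℝ) 1)
    (hθc : ContinuousOn θ (Icc 0 T))
    (x y : ℝ → ℝ)
    (hxr : ∀ t ∈ Icc (0:ℝ) T, x t ∈ Icc (-(1/2) : ℝ) (1/2))
    (hyr : ∀ t ∈ Icc (0:ℝ) T, y t ∈ Icc (-(1/2) : ℝ) (1/2))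
    (hx : ∀ t ∈ Icc (0:ℝ) T, HasDerivAt x
      (-(g t * (x t * (1 - x t ^ 2))) - (1 - g t) * x t + θ t) t)
    (hy : ∀ t ∈ Icc (0:ℝ) T, HasDerivAt y
      (-(g t * (y t * (1 - y t ^ 2))) - (1 - g t) * y t + θ t) t) :
    ∀ t ∈ Icc (0:ℝ) T, |x t - y t| ≤ Real.exp (-t / 4) * |x 0 - y 0| := by
  intro t ht
  have h := abs_le_exp_mul_of_mul_deriv_le (k := 1/4) (fun s hs => (hx s hs).sub (hy s hs))
    (fun s hs => cubic_field_one_sided_lipschitz (hgr s hs) (hxr s hs) (hyr s hs)) ht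
  rwa [show -(1/4 * t) = -t / 4 by ring] at h
end
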